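/- Let U ⊆ ℂⁿ be open and let wᵢ, aᵢ, bᵢ : U → ℂ be holomorphic. Let Γ₁, Γ₂ : U → U be holomorphic maps, f₁, f₂ : U → ℂ nowhere-vanishing holomorphic functions with Γₗ*ω = fₗ·ω, let g₁, g₂ : U → ℂ be holomorphic with (Γₗ*α)ᵢ − aᵢ + ∂ᵢfₗ/fₗ = gₗ·wᵢ for all i, and let h₁, h₂ : U → ℂ be holomorphic with fₗ·(Γₗ*β)ᵢ − bᵢ − gₗ·aᵢ + ∂ᵢgₗ = hₗ·wᵢ for all i and ℓ = 1, 2. Then, setting f₁₂ := (f₁∘Γ₂)·f₂, g₁₂ := (g₁∘Γ₂)·f₂ + g₂ and h₁₂ := h₂ + (h₁∘Γ₂)·f₂² + (g₁∘Γ₂)·g₂·f₂, one has for all i: f₁₂·((Γ₁∘Γ₂)*β)ᵢ − bᵢ − g₁₂·aᵢ + ∂ᵢg₁₂ = h₁₂·wᵢ, and moreover h₁₂ − ½g₁₂² = (h₂ − ½g₂²) + ((h₁ − ½g₁²)∘Γ₂)·f₂². -/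

import Mathlib

open scoped BigOperators

/-- The `i`-th complex partial derivative of `f : ℂⁿ → ℂ` at `x`. -/
noncomputable def pd {n : ℕ} (i : Fin n) (f : (Fin n → ℂ) → ℂ) (x : Fin n → ℂ) : ℂ :=
  fderiv ℂ f x (Pi.single i 1)

/-- The `i`-th component of the pullback `Γ*η` of the 1-form `η = Σⱼ hⱼ dxⱼ`
under `Γ : ℂⁿ → ℂⁿ`: `(Γ*η)ᵢ = Σⱼ (hⱼ ∘ Γ) · ∂ᵢΓⱼ`. -/
noncomputable def pullback1 {n : ℕ} (Γ : (Fin n → ℂ) → (Fin n → ℂ))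
    (h : Fin n → (Fin n → ℂ) → ℂ) (i : Fin n) (x : Fin n → ℂ) : ℂ :=
  ∑ j, h j (Γ x) * pd i (fun y => Γ y j) x

/-- Chain rule: `d(φ ∘ Γ) = Γ*(dφ)`. -/
theorem pd_comp {n : ℕ} {φ : (Fin n → ℂ) → ℂ} {Γ : (Fin n → ℂ) → (Fin n → ℂ)}
    {x : Fin n → ℂ} (hφ : DifferentiableAt ℂ φ (Γ x)) (hΓ : DifferentiableAt ℂ Γ x)
    (i : Fin n) :
    pd i (fun y => φ (Γ y)) x = pullback1 Γ (fun j => pd j φ) i x := by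
  have hcomp : fderiv ℂ (fun y => φ (Γ y)) x = (fderiv ℂ φ (Γ x)).comp (fderiv ℂ Γ x) :=
    fderiv_comp x hφ hΓ
  have hcoord (j : Fin n) : pd i (fun y => Γ y j) x = fderiv ℂ Γ x (Pi.single i 1) j := by
    rw [pd, fderiv_apply hΓ]
    rfl
  simp only [pullback1, hcoord]
  rw [pd, hcomp, ContinuousLinearMap.comp_apply]
  conv_lhs => rw [pi_eq_sum_univ' (fderiv ℂ Γ x (Pi.single i 1)), map_sum]
  refine Finset.sum_congr rfl fun j _ => ?_
  rw [map_smul, smul_eq_mul, mul_comm, pd]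

/-- Functoriality of the pullback: `(Γ₁ ∘ Γ₂)*η = Γ₂*(Γ₁*η)`. -/
theorem pullback1_comp {n : ℕ} {Γ₁ Γ₂ : (Fin n → ℂ) → (Fin n → ℂ)} {x : Fin n → ℂ}
    (hΓ₁ : DifferentiableAt ℂ Γ₁ (Γ₂ x)) (hΓ₂ : DifferentiableAt ℂ Γ₂ x)
    (η : Fin n → (Fin n → ℂ) → ℂ) (i : Fin n) :
    pullback1 (Γ₁ ∘ Γ₂) η i x = pullback1 Γ₂ (pullback1 Γ₁ η) i x := by
  have hchain (j : Fin n) : pd i (fun y => Γ₁ (Γ₂ y) j) x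
      = ∑ k, pd k (fun y => Γ₁ y j) (Γ₂ x) * pd i (fun y => Γ₂ y k) x :=
    pd_comp (φ := fun y => Γ₁ y j) (differentiableAt_pi.1 hΓ₁ j) hΓ₂ i
  simp only [pullback1, Function.comp_apply, hchain, Finset.mul_sum, Finset.sum_mul, mul_assoc]
  rw [Finset.sum_comm]

/-- Leibniz rule for `d(uv + t)`. -/
theorem pd_mul_add {n : ℕ} {u v t : (Fin n → ℂ) → ℂ} {x : Fin n → ℂ}
    (hu : DifferentiableAt ℂ u x) (hv : DifferentiableAt ℂ v x) (ht : DifferentiableAt ℂ t x)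
    (i : Fin n) :
    pd i (fun y => u y * v y + t y) x = u x * pd i v x + v x * pd i u x + pd i t x := by
  have h := ((hu.hasFDerivAt.mul hv.hasFDerivAt).add ht.hasFDerivAt).fderiv
  exact congrArg (fun L => L (Pi.single i 1)) h

/-- Cocycle rule for the coefficient `h_Γ`: with `f₁₂ = (f₁∘Γ₂)·f₂`,
`g₁₂ = (g₁∘Γ₂)·f₂ + g₂` and `h₁₂ = h₂ + (h₁∘Γ₂)·f₂² + (g₁∘Γ₂)·g₂·f₂`, the composition
`Γ₁∘Γ₂` satisfies `f₁₂·(Γ₁∘Γ₂)*β − β − g₁₂·α + dg₁₂ = h₁₂·ω`, and moreover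
`h₁₂ − ½g₁₂² = (h₂ − ½g₂²) + ((h₁ − ½g₁²)∘Γ₂)·f₂²`. -/
theorem cocycle_h {n : ℕ}
    (U : Set (Fin n → ℂ)) (hU : IsOpen U)
    (w α β : Fin n → (Fin n → ℂ) → ℂ)
    (hw : ∀ i, DifferentiableOn ℂ (w i) U)
    (hα : ∀ i, DifferentiableOn ℂ (α i) U)
    (hβ : ∀ i, DifferentiableOn ℂ (β i) U)
    (Γ₁ Γ₂ : (Fin n → ℂ) → (Fin n → ℂ))
    (hΓ₁ : DifferentiableOn ℂ Γ₁ U) (hΓ₁maps : Set.MapsTo Γ₁ U U)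
    (hΓ₂ : DifferentiableOn ℂ Γ₂ U) (hΓ₂maps : Set.MapsTo Γ₂ U U)
    (f₁ f₂ : (Fin n → ℂ) → ℂ)
    (hf₁ : DifferentiableOn ℂ f₁ U) (hf₁0 : ∀ x ∈ U, f₁ x ≠ 0)
    (hf₂ : DifferentiableOn ℂ f₂ U) (hf₂0 : ∀ x ∈ U, f₂ x ≠ 0)
    (hpullω₁ : ∀ i, ∀ x ∈ U, pullback1 Γ₁ w i x = f₁ x * w i x)
    (hpullω₂ : ∀ i, ∀ x ∈ U, pullback1 Γ₂ w i x = f₂ x * w i x)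
    (g₁ g₂ : (Fin n → ℂ) → ℂ)
    (hg₁ : DifferentiableOn ℂ g₁ U) (hg₂ : DifferentiableOn ℂ g₂ U)
    (hpullα₁ : ∀ i, ∀ x ∈ U,
      pullback1 Γ₁ α i x - α i x + pd i f₁ x / f₁ x = g₁ x * w i x)
    (hpullα₂ : ∀ i, ∀ x ∈ U,
      pullback1 Γ₂ α i x - α i x + pd i f₂ x / f₂ x = g₂ x * w i x)
    (h₁ h₂ : (Fin n → ℂ) → ℂ)
    (hh₁ : DifferentiableOn ℂ h₁ U) (hh₂ : DifferentiableOn ℂ h₂ U)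
    (hpullβ₁ : ∀ i, ∀ x ∈ U,
      f₁ x * pullback1 Γ₁ β i x - β i x - g₁ x * α i x + pd i g₁ x = h₁ x * w i x)
    (hpullβ₂ : ∀ i, ∀ x ∈ U,
      f₂ x * pullback1 Γ₂ β i x - β i x - g₂ x * α i x + pd i g₂ x = h₂ x * w i x) :
    (∀ i, ∀ x ∈ U,
      (f₁ (Γ₂ x) * f₂ x) * pullback1 (Γ₁ ∘ Γ₂) β i x - β i x
          - (g₁ (Γ₂ x) * f₂ x + g₂ x) * α i x
          + pd i (fun y => g₁ (Γ₂ y) * f₂ y + g₂ y) x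
        = (h₂ x + h₁ (Γ₂ x) * f₂ x ^ 2 + g₁ (Γ₂ x) * g₂ x * f₂ x) * w i x) ∧
    (∀ x ∈ U,
      (h₂ x + h₁ (Γ₂ x) * f₂ x ^ 2 + g₁ (Γ₂ x) * g₂ x * f₂ x)
          - (1 / 2) * (g₁ (Γ₂ x) * f₂ x + g₂ x) ^ 2
        = (h₂ x - (1 / 2) * g₂ x ^ 2)
          + (h₁ (Γ₂ x) - (1 / 2) * g₁ (Γ₂ x) ^ 2) * f₂ x ^ 2) := by
  refine ⟨fun i x hx => ?_, fun x _ => by ring⟩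
  have hΓx := hΓ₂maps hx
  have dΓ₁ := hΓ₁.differentiableAt (hU.mem_nhds hΓx)
  have dΓ₂ := hΓ₂.differentiableAt (hU.mem_nhds hx)
  have dg₁ := hg₁.differentiableAt (hU.mem_nhds hΓx)
  have dg₂ := hg₂.differentiableAt (hU.mem_nhds hx)
  have df₂ := hf₂.differentiableAt (hU.mem_nhds hx)
  -- the relation defining `h₁`, pulled back along `Γ₂`
  have pulled : f₁ (Γ₂ x) * pullback1 Γ₂ (pullback1 Γ₁ β) i x - pullback1 Γ₂ β i x
      - g₁ (Γ₂ x) * pullback1 Γ₂ α i x + pullback1 Γ₂ (fun j => pd j g₁) i x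
      = h₁ (Γ₂ x) * pullback1 Γ₂ w i x := by
    rw [pullback1, pullback1, pullback1, pullback1, pullback1]
    simp only [Finset.mul_sum, ← Finset.sum_sub_distrib, ← Finset.sum_add_distrib]
    refine Finset.sum_congr rfl fun j _ => ?_
    linear_combination pd i (fun y => Γ₂ y j) x * hpullβ₁ j (Γ₂ x) hΓx
  have hα₂ := hpullα₂ i x hx
  field_simp [hf₂0 x hx] at hα₂
  rw [pd_mul_add (u := fun y => g₁ (Γ₂ y)) (dg₁.comp x dΓ₂) df₂ dg₂, pd_comp dg₁ dΓ₂,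
    pullback1_comp dΓ₁ dΓ₂]
  linear_combination f₂ x * pulled + hpullβ₂ i x hx + g₁ (Γ₂ x) * hα₂
    + h₁ (Γ₂ x) * f₂ x * hpullω₂ i x hx
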